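/- arXiv:1603.03946 — 2 statements merged into one kernel-verified Lean document; each statement's English description precedes it below -/
import Mathlib

section
/- Let Q ∈ {2, 3, 4}, let n, r be positive integers, and let A be a nonzero complex number satisfying A² + A^{−2} + √Q = 0 (equivalently A⁴ + √Q·A² + 1 = 0). Define the weight w : Fin Q × Fin Q → ℂ by w(s,t) = −A³ if s = t and w(s,t) = A^{−1} if s ≠ t. For each i ∈ {1,…,r} let E_i be a finite multiset of (ordered) pairs of elements of Fin n, and for σ : Fin n → Fin Q set f_i(σ) = ∏_{(u,v) ∈ E_i} w(σ(u), σ(v)). Then the r × r complex matrix M with entries M_{ij} = Σ_{σ : Fin n → Fin Q} f_i(σ) · (f_j(σ))^{−1} is Hermitian and positive semidefinite. -/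
open ComplexOrder

/-- A root of `z² + s z + 1` with `s` real and `s² ≤ 4` lies on the unit circle. -/
lemma norm_eq_one_of_sq_add_mul_add_one_eq_zero {z : ℂ} {s : ℝ} (hs : s ^ 2 ≤ 4)
    (hz : z ^ 2 + s * z + 1 = 0) : ‖z‖ = 1 := by
  have hre := congrArg Complex.re hz
  have him := congrArg Complex.im hz
  simp only [pow_two, Complex.add_re, Complex.add_im, Complex.mul_re, Complex.mul_im,
    Complex.ofReal_re, Complex.ofReal_im, Complex.one_re, Complex.one_im, Complex.zero_re,
    Complex.zero_im] at hre him
  have hsq : ‖z‖ ^ 2 = 1 := by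
    rw [Complex.sq_norm, Complex.normSq_apply]
    by_cases hy : z.im = 0
    · rw [hy] at hre ⊢
      have hx : z.re + s / 2 = 0 := by
        apply pow_eq_zero_iff two_ne_zero |>.mp
        nlinarith [sq_nonneg (z.re + s / 2)]
      have hx' : s = -2 * z.re := by linarith
      rw [hx'] at hre
      linarith
    · have hx : 2 * z.re + s = 0 := by
        apply mul_right_cancel₀ hy
        linarith
      have hx' : s = -2 * z.re := by linarith
      rw [hx'] at hre
      linarith
  exact (pow_eq_one_iff_of_nonneg (norm_nonneg z) two_ne_zero).mp hsq

/-- A product of a multiset of complex numbers of norm one has norm one. -/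
lemma norm_multiset_prod_map_eq_one {ι : Type*} (m : Multiset ι) {g : ι → ℂ}
    (hg : ∀ i, ‖g i‖ = 1) : ‖(m.map g).prod‖ = 1 := by
  induction m using Multiset.induction_on with
  | empty => simp
  | cons a m ih => simp [hg a, ih]

/-- The Gram-type matrix of Kauffman-bracket (Potts) weights at a
root of `A² + A⁻² + √Q = 0`, `Q ∈ {2,3,4}`, is Hermitian and positive
semidefinite. -/
theorem kauffman_gram_posSemidef
    (Q : ℕ) (hQ : Q = 2 ∨ Q = 3 ∨ Q = 4)
    (n r : ℕ) (hn : 0 < n) (hr : 0 < r)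
    (A : ℂ) (hA : A ≠ 0)
    (hAeq : A ^ 2 + (A ^ 2)⁻¹ + (Real.sqrt Q : ℂ) = 0)
    (w : Fin Q → Fin Q → ℂ)
    (hw : ∀ s t, w s t = if s = t then -A ^ 3 else A⁻¹)
    (E : Fin r → Multiset (Fin n × Fin n))
    (f : Fin r → (Fin n → Fin Q) → ℂ)
    (hf : ∀ i σ, f i σ = ((E i).map (fun p => w (σ p.1) (σ p.2))).prod)
    (M : Matrix (Fin r) (Fin r) ℂ)
    (hM : ∀ i j, M i j = ∑ σ : Fin n → Fin Q, f i σ * (f j σ)⁻¹) :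
    M.IsHermitian ∧ M.PosSemidef := by
  have hs : (√(Q : ℝ)) ^ 2 ≤ 4 := by
    rw [Real.sq_sqrt (Nat.cast_nonneg Q)]
    rcases hQ with rfl | rfl | rfl <;> norm_num
  have hz : (A ^ 2) ^ 2 + (√(Q : ℝ) : ℂ) * A ^ 2 + 1 = 0 := by
    have hmul : A ^ 2 * (A ^ 2)⁻¹ = 1 := mul_inv_cancel₀ (pow_ne_zero 2 hA)
    linear_combination A ^ 2 * hAeq - hmul
  have hA1 : ‖A‖ = 1 := by
    have h := norm_eq_one_of_sq_add_mul_add_one_eq_zero hs hz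
    rw [norm_pow] at h
    exact (pow_eq_one_iff_of_nonneg (norm_nonneg A) two_ne_zero).mp h
  have hw1 : ∀ s t, ‖w s t‖ = 1 := by
    intro s t
    rw [hw]
    split_ifs <;> simp [hA1]
  have hf1 : ∀ i σ, ‖f i σ‖ = 1 := fun i σ => by
    rw [hf]
    exact norm_multiset_prod_map_eq_one _ fun p => hw1 _ _
  have hMB : M = Matrix.of f * (Matrix.of f).conjTranspose := by
    ext i j
    rw [hM, Matrix.mul_apply]
    refine Finset.sum_congr rfl fun σ _ => ?_
    rw [Complex.inv_eq_conj (hf1 j σ)]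
    rfl
  have hpos : M.PosSemidef := hMB ▸ Matrix.posSemidef_self_mul_conjTranspose _
  exact ⟨hpos.isHermitian, hpos⟩
end

section
/- Let X be a finite set, let k be a positive integer, and let m_1, …, m_r be involutive permutations of X (m_i ∘ m_i = id). For each pair (i,j) let c(i,j) denote the number of orbits of the action on X of the subgroup of the permutation group of X generated by m_i and m_j. Then the r × r real matrix with (i,j)-entry k^{c(i,j)} is positive semidefinite. -/
/-- Functions invariant under every permutation in `S` are the same as functions on the orbits of
the subgroup generated by `S`. -/
def invariantFunctionsEquiv {X : Type*} (C : Type*) (S : Set (Equiv.Perm X)) :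
    {τ : X → C // ∀ g ∈ S, ∀ x, τ (g x) = τ x} ≃
      (MulAction.orbitRel.Quotient (Subgroup.closure S) X → C) where
  toFun τ := Quotient.lift τ.1 (by
    have invariant : ∀ g ∈ Subgroup.closure S, ∀ x, τ.1 (g x) = τ.1 x := by
      intro g hg
      induction hg using Subgroup.closure_induction with
      | mem g hg => exact τ.2 g hg
      | one => simp
      | mul g h _ _ ihg ihh => intro x; rw [Equiv.Perm.mul_apply, ihg, ihh]
      | inv g _ ih => intro x; rw [← ih (g⁻¹ x), ← Equiv.Perm.mul_apply, mul_inv_cancel, Equiv.Perm.one_apply]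
    rintro a b ⟨g, rfl⟩
    exact invariant g g.2 b)
  invFun f := ⟨fun x => f (Quotient.mk _ x), fun g hg x =>
    congrArg f (Quotient.sound ⟨⟨g, Subgroup.subset_closure hg⟩, rfl⟩)⟩
  left_inv _ := rfl
  right_inv f := by
    ext q
    induction q using Quotient.inductionOn
    rfl

theorem card_invariant_functions {X : Type*} [Finite X] (k : ℕ) (S : Set (Equiv.Perm X)) :
    Nat.card {τ : X → Fin k // ∀ g ∈ S, ∀ x, τ (g x) = τ x} =
      k ^ Nat.card (MulAction.orbitRel.Quotient (Subgroup.closure S) X) := by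
  have : Finite (MulAction.orbitRel.Quotient (Subgroup.closure S) X) := Quotient.finite _
  rw [Nat.card_congr (invariantFunctionsEquiv (Fin k) S), Nat.card_fun, Nat.card_fin]


/-- If `m₁, …, m_r` are involutive permutations of a finite set `X`
and `c i j` is the number of orbits of the subgroup generated by `m i` and
`m j` acting on `X`, then the matrix `(k ^ c i j)` is positive semidefinite. -/
theorem orbit_count_gram_posSemidef
    (X : Type*) [Fintype X] (k : ℕ) (hk : 0 < k) (r : ℕ)
    (m : Fin r → Equiv.Perm X)
    (hm : ∀ i, m i ∘ m i = id)
    (c : Fin r → Fin r → ℕ)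
    (hc : ∀ i j, c i j =
      Nat.card (MulAction.orbitRel.Quotient
        (Subgroup.closure {m i, m j} : Subgroup (Equiv.Perm X)) X))
    (M : Matrix (Fin r) (Fin r) ℝ)
    (hM : ∀ i j, M i j = (k : ℝ) ^ c i j) :
    M.PosSemidef := by
  classical
  let A : Matrix (X → Fin k) (Fin r) ℝ :=
    Matrix.of fun τ i => if ∀ x, τ (m i x) = τ x then 1 else 0
  have gram : M = A.conjTranspose * A := by
    ext i j
    rw [hM, hc, ← Nat.cast_pow, ← card_invariant_functions, Nat.card_eq_fintype_card,
      Fintype.card_subtype]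
    simp [A, Matrix.mul_apply, ← ite_and, Finset.sum_boole, and_comm]
  rw [gram]
  exact Matrix.posSemidef_conjTranspose_mul_self A
end
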